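/- Let x* be a strict local minimizer of the cardinality constrained problem (CCP) at which CC-MFCQ holds. Then there exist T > 0 and r > 0 such that for every t ∈ (0, T] the regularized program NLP(t) has a local minimum (x^t, y^t) with ‖x^t − x*‖ < r which is a KKT point of NLP(t). -/

import Mathlib

open Set Filter Topology

noncomputable section

/-- Number of nonzero components of a vector (the "zero norm"). -/
def card0 {n : ℕ} (x : Fin n → ℝ) : ℕ := {i | x i ≠ 0}.ncard

/-- First directional derivative `∇φ(x)ᵀd`. -/
def D1 {n : ℕ} (φ : (Fin n → ℝ) → ℝ) (x d : Fin n → ℝ) : ℝ := fderiv ℝ φ x d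

/-- Second derivative quadratic form `dᵀ∇²φ(x)d`. -/
def D2 {n : ℕ} (φ : (Fin n → ℝ) → ℝ) (x d : Fin n → ℝ) : ℝ :=
  iteratedFDeriv ℝ 2 φ x ![d, d]

/-- Feasibility for the cardinality constrained problem (CCP):
`g(x) ≤ 0`, `h(x) = 0`, `‖x‖₀ ≤ κ`. -/
def CCPFeasible {n m p : ℕ} (g : (Fin n → ℝ) → Fin m → ℝ) (h : (Fin n → ℝ) → Fin p → ℝ)
    (κ : ℕ) (x : Fin n → ℝ) : Prop :=
  (∀ i, g x i ≤ 0) ∧ (∀ i, h x i = 0) ∧ card0 x ≤ κ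

/-- Feasible set `Z` of the continuous reformulation. -/
def ZSet {n m p : ℕ} (g : (Fin n → ℝ) → Fin m → ℝ) (h : (Fin n → ℝ) → Fin p → ℝ)
    (κ : ℕ) : Set ((Fin n → ℝ) × (Fin n → ℝ)) :=
  {z | (∀ i, g z.1 i ≤ 0) ∧ (∀ i, h z.1 i = 0) ∧ (∀ i, 0 ≤ z.2 i) ∧ (∀ i, z.2 i ≤ 1) ∧
    ((n : ℝ) - (κ : ℝ) ≤ ∑ i, z.2 i) ∧ ∀ i, z.1 i * z.2 i = 0}

/-- `(lam, mu, gam)` is an M-stationary multiplier at `x`. -/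
def IsMMult {n m p : ℕ} (f : (Fin n → ℝ) → ℝ) (g : (Fin n → ℝ) → Fin m → ℝ)
    (h : (Fin n → ℝ) → Fin p → ℝ) (x : Fin n → ℝ)
    (lam : Fin m → ℝ) (mu : Fin p → ℝ) (gam : Fin n → ℝ) : Prop :=
  (∀ d, D1 f x d + ∑ i, lam i * D1 (fun x' => g x' i) x d
      + ∑ i, mu i * D1 (fun x' => h x' i) x d + ∑ i, gam i * d i = 0) ∧
  (∀ i, 0 ≤ lam i) ∧ (∀ i, lam i * g x i = 0) ∧ (∀ i, x i ≠ 0 → gam i = 0)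

/-- `(lam, mu, gam)` is an S-stationary multiplier at `(x, y)`. -/
def IsSMult {n m p : ℕ} (f : (Fin n → ℝ) → ℝ) (g : (Fin n → ℝ) → Fin m → ℝ)
    (h : (Fin n → ℝ) → Fin p → ℝ) (x y : Fin n → ℝ)
    (lam : Fin m → ℝ) (mu : Fin p → ℝ) (gam : Fin n → ℝ) : Prop :=
  IsMMult f g h x lam mu gam ∧ ∀ i, x i = 0 → y i = 0 → gam i = 0

/-- `z` is an M-stationary point of the continuous reformulation. -/
def MStationary {n m p : ℕ} (f : (Fin n → ℝ) → ℝ) (g : (Fin n → ℝ) → Fin m → ℝ)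
    (h : (Fin n → ℝ) → Fin p → ℝ) (κ : ℕ) (z : (Fin n → ℝ) × (Fin n → ℝ)) : Prop :=
  z ∈ ZSet g h κ ∧ ∃ lam mu gam, IsMMult f g h z.1 lam mu gam

/-- `z` is an S-stationary point of the continuous reformulation. -/
def SStationary {n m p : ℕ} (f : (Fin n → ℝ) → ℝ) (g : (Fin n → ℝ) → Fin m → ℝ)
    (h : (Fin n → ℝ) → Fin p → ℝ) (κ : ℕ) (z : (Fin n → ℝ) × (Fin n → ℝ)) : Prop :=
  z ∈ ZSet g h κ ∧ ∃ lam mu gam, IsSMult f g h z.1 z.2 lam mu gam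

/-- CC-LICQ at `x`: the active gradients `∇gᵢ(x)` (`gᵢ(x) = 0`), all `∇hᵢ(x)`,
and the unit vectors `eᵢ` (`xᵢ = 0`) are linearly independent. -/
def CCLICQ {n m p : ℕ} (g : (Fin n → ℝ) → Fin m → ℝ) (h : (Fin n → ℝ) → Fin p → ℝ)
    (x : Fin n → ℝ) : Prop :=
  ∀ (lam : Fin m → ℝ) (mu : Fin p → ℝ) (gam : Fin n → ℝ),
    (∀ i, g x i ≠ 0 → lam i = 0) → (∀ i, x i ≠ 0 → gam i = 0) →
    (∀ d, ∑ i, lam i * D1 (fun x' => g x' i) x d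
        + ∑ i, mu i * D1 (fun x' => h x' i) x d + ∑ i, gam i * d i = 0) →
    lam = 0 ∧ mu = 0 ∧ gam = 0

/-- CC-MFCQ at `x`: the active gradients `∇gᵢ(x)` together with all `∇hᵢ(x)` and the
unit vectors `eᵢ` (`xᵢ = 0`) are positively linearly independent. -/
def CCMFCQ {n m p : ℕ} (g : (Fin n → ℝ) → Fin m → ℝ) (h : (Fin n → ℝ) → Fin p → ℝ)
    (x : Fin n → ℝ) : Prop :=
  ∀ (lam : Fin m → ℝ) (mu : Fin p → ℝ) (gam : Fin n → ℝ),
    (∀ i, 0 ≤ lam i) → (∀ i, g x i ≠ 0 → lam i = 0) → (∀ i, x i ≠ 0 → gam i = 0) →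
    (∀ d, ∑ i, lam i * D1 (fun x' => g x' i) x d
        + ∑ i, mu i * D1 (fun x' => h x' i) x d + ∑ i, gam i * d i = 0) →
    lam = 0 ∧ mu = 0 ∧ gam = 0

/-- The linear combination `Σ lamᵢ ∇gᵢ(x) + Σ muᵢ ∇hᵢ(x) + Σ gamᵢ eᵢ` vanishes. -/
def CombZero {n m p : ℕ} (g : (Fin n → ℝ) → Fin m → ℝ) (h : (Fin n → ℝ) → Fin p → ℝ)
    (lam : Fin m → ℝ) (mu : Fin p → ℝ) (gam : Fin n → ℝ) (x : Fin n → ℝ) : Prop :=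
  ∀ d, ∑ i, lam i * D1 (fun x' => g x' i) x d
      + ∑ i, mu i * D1 (fun x' => h x' i) x d + ∑ i, gam i * d i = 0

/-- CC-CPLD at `x`: whenever gradients indexed by subsets of the active sets are
positively linearly dependent at `x`, they remain linearly dependent nearby. -/
def CCCPLD {n m p : ℕ} (g : (Fin n → ℝ) → Fin m → ℝ) (h : (Fin n → ℝ) → Fin p → ℝ)
    (x : Fin n → ℝ) : Prop :=
  ∀ (I1 : Finset (Fin m)) (I2 : Finset (Fin p)) (I3 : Finset (Fin n)),
    (∀ i ∈ I1, g x i = 0) → (∀ i ∈ I3, x i = 0) →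
    (∃ lam mu gam, (∀ i, 0 ≤ lam i) ∧ (∀ i, i ∉ I1 → lam i = 0) ∧ (∀ i, i ∉ I2 → mu i = 0) ∧
      (∀ i, i ∉ I3 → gam i = 0) ∧ ¬(lam = 0 ∧ mu = 0 ∧ gam = 0) ∧ CombZero g h lam mu gam x) →
    ∀ᶠ x' in nhds x, ∃ lam mu gam, (∀ i, i ∉ I1 → lam i = 0) ∧ (∀ i, i ∉ I2 → mu i = 0) ∧
      (∀ i, i ∉ I3 → gam i = 0) ∧ ¬(lam = 0 ∧ mu = 0 ∧ gam = 0) ∧ CombZero g h lam mu gam x'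

/-- The CC-linearisation cone `L_Z(x, y)` (as a predicate on `(dx, dy)`). -/
def LinCone {n m p : ℕ} (g : (Fin n → ℝ) → Fin m → ℝ) (h : (Fin n → ℝ) → Fin p → ℝ)
    (κ : ℕ) (x y dx dy : Fin n → ℝ) : Prop :=
  (∀ i, g x i = 0 → D1 (fun x' => g x' i) x dx ≤ 0) ∧
  (∀ i, D1 (fun x' => h x' i) x dx = 0) ∧
  ((∑ i, y i = (n : ℝ) - (κ : ℝ)) → 0 ≤ ∑ i, dy i) ∧
  (∀ i, x i ≠ 0 → y i = 0 → dy i = 0) ∧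
  (∀ i, x i = 0 → y i = 0 → 0 ≤ dy i) ∧
  (∀ i, x i = 0 → y i = 1 → dy i ≤ 0) ∧
  (∀ i, x i = 0 → 0 < y i → dx i = 0) ∧
  (∀ i, x i = 0 → y i = 0 → dx i * dy i = 0)

/-- The CC-critical cone `C_Z(x, y)`. -/
def CritCone {n m p : ℕ} (f : (Fin n → ℝ) → ℝ) (g : (Fin n → ℝ) → Fin m → ℝ)
    (h : (Fin n → ℝ) → Fin p → ℝ) (κ : ℕ) (x y dx dy : Fin n → ℝ) : Prop :=
  LinCone g h κ x y dx dy ∧ D1 f x dx ≤ 0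

/-- The critical cone `C_X(x)` for the original cardinality constrained problem. -/
def CritConeX {n m p : ℕ} (f : (Fin n → ℝ) → ℝ) (g : (Fin n → ℝ) → Fin m → ℝ)
    (h : (Fin n → ℝ) → Fin p → ℝ) (κ : ℕ) (x dx : Fin n → ℝ) : Prop :=
  (∀ i, g x i = 0 → D1 (fun x' => g x' i) x dx ≤ 0) ∧
  (∀ i, D1 (fun x' => h x' i) x dx = 0) ∧
  (n - κ ≤ {i | x i = 0 ∧ dx i = 0}.ncard) ∧
  D1 f x dx ≤ 0

/-- `x` is a local minimum of the cardinality constrained problem. -/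
def LocalMinCCP {n m p : ℕ} (f : (Fin n → ℝ) → ℝ) (g : (Fin n → ℝ) → Fin m → ℝ)
    (h : (Fin n → ℝ) → Fin p → ℝ) (κ : ℕ) (x : Fin n → ℝ) : Prop :=
  CCPFeasible g h κ x ∧ ∃ r > (0 : ℝ), ∀ x', CCPFeasible g h κ x' → dist x' x < r → f x ≤ f x'

/-- `x` is a strict local minimum of the cardinality constrained problem. -/
def StrictLocalMinCCP {n m p : ℕ} (f : (Fin n → ℝ) → ℝ) (g : (Fin n → ℝ) → Fin m → ℝ)
    (h : (Fin n → ℝ) → Fin p → ℝ) (κ : ℕ) (x : Fin n → ℝ) : Prop :=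
  CCPFeasible g h κ x ∧
    ∃ r > (0 : ℝ), ∀ x', CCPFeasible g h κ x' → dist x' x < r → x' ≠ x → f x < f x'

/-- `z` is a local minimum of the continuous reformulation. -/
def LocalMinZ {n m p : ℕ} (f : (Fin n → ℝ) → ℝ) (g : (Fin n → ℝ) → Fin m → ℝ)
    (h : (Fin n → ℝ) → Fin p → ℝ) (κ : ℕ) (z : (Fin n → ℝ) × (Fin n → ℝ)) : Prop :=
  z ∈ ZSet g h κ ∧ ∃ r > (0 : ℝ), ∀ z' ∈ ZSet g h κ, dist z' z < r → f z.1 ≤ f z'.1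

/-- `z` is a strict local minimum with respect to `x` of the continuous reformulation. -/
def StrictLocalMinX {n m p : ℕ} (f : (Fin n → ℝ) → ℝ) (g : (Fin n → ℝ) → Fin m → ℝ)
    (h : (Fin n → ℝ) → Fin p → ℝ) (κ : ℕ) (z : (Fin n → ℝ) × (Fin n → ℝ)) : Prop :=
  z ∈ ZSet g h κ ∧
    ∃ r > (0 : ℝ), ∀ z' ∈ ZSet g h κ, dist z' z < r → z'.1 ≠ z.1 → f z.1 < f z'.1

/-- Feasible set `Z(t)` of the Scholtes-type regularized program NLP(t). -/
def ZReg {n m p : ℕ} (g : (Fin n → ℝ) → Fin m → ℝ) (h : (Fin n → ℝ) → Fin p → ℝ)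
    (κ : ℕ) (t : ℝ) : Set ((Fin n → ℝ) × (Fin n → ℝ)) :=
  {z | (∀ i, g z.1 i ≤ 0) ∧ (∀ i, h z.1 i = 0) ∧ (∀ i, 0 ≤ z.2 i) ∧ (∀ i, z.2 i ≤ 1) ∧
    ((n : ℝ) - (κ : ℝ) ≤ ∑ i, z.2 i) ∧ (∀ i, z.1 i * z.2 i ≤ t) ∧ ∀ i, -t ≤ z.1 i * z.2 i}

/-- `z` is a local minimum of the regularized program NLP(t). -/
def LocalMinReg {n m p : ℕ} (f : (Fin n → ℝ) → ℝ) (g : (Fin n → ℝ) → Fin m → ℝ)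
    (h : (Fin n → ℝ) → Fin p → ℝ) (κ : ℕ) (t : ℝ) (z : (Fin n → ℝ) × (Fin n → ℝ)) : Prop :=
  z ∈ ZReg g h κ t ∧ ∃ r > (0 : ℝ), ∀ z' ∈ ZReg g h κ t, dist z' z < r → f z.1 ≤ f z'.1

/-- `z` is a KKT point of the regularized program NLP(t). -/
def KKTReg {n m p : ℕ} (f : (Fin n → ℝ) → ℝ) (g : (Fin n → ℝ) → Fin m → ℝ)
    (h : (Fin n → ℝ) → Fin p → ℝ) (κ : ℕ) (t : ℝ) (z : (Fin n → ℝ) × (Fin n → ℝ)) : Prop :=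
  z ∈ ZReg g h κ t ∧
  ∃ (lam : Fin m → ℝ) (mu : Fin p → ℝ) (nu0 nu1 : Fin n → ℝ) (rho : ℝ) (dpl dmi : Fin n → ℝ),
    (∀ d : Fin n → ℝ, D1 f z.1 d + ∑ i, lam i * D1 (fun x' => g x' i) z.1 d
        + ∑ i, mu i * D1 (fun x' => h x' i) z.1 d
        + ∑ i, (dpl i - dmi i) * z.2 i * d i = 0) ∧
    (∀ i, -nu0 i + nu1 i - rho + (dpl i - dmi i) * z.1 i = 0) ∧
    (∀ i, 0 ≤ lam i) ∧ (∀ i, 0 ≤ nu0 i) ∧ (∀ i, 0 ≤ nu1 i) ∧ 0 ≤ rho ∧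
    (∀ i, 0 ≤ dpl i) ∧ (∀ i, 0 ≤ dmi i) ∧
    (∀ i, lam i * g z.1 i = 0) ∧ (∀ i, nu0 i * z.2 i = 0) ∧ (∀ i, nu1 i * (z.2 i - 1) = 0) ∧
    rho * (∑ i, z.2 i - ((n : ℝ) - (κ : ℝ))) = 0 ∧
    (∀ i, dpl i * (z.1 i * z.2 i - t) = 0) ∧ (∀ i, dmi i * (z.1 i * z.2 i + t) = 0)

/-- Standard MFCQ for the regularized program NLP(t) at a feasible point `z`. -/
def MFCQReg {n m p : ℕ} (g : (Fin n → ℝ) → Fin m → ℝ) (h : (Fin n → ℝ) → Fin p → ℝ)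
    (κ : ℕ) (t : ℝ) (z : (Fin n → ℝ) × (Fin n → ℝ)) : Prop :=
  (∀ mu : Fin p → ℝ, (∀ d, ∑ i, mu i * D1 (fun x' => h x' i) z.1 d = 0) → mu = 0) ∧
  ∃ dx dy : Fin n → ℝ,
    (∀ i, D1 (fun x' => h x' i) z.1 dx = 0) ∧
    (∀ i, g z.1 i = 0 → D1 (fun x' => g x' i) z.1 dx < 0) ∧
    (∀ i, z.2 i = 0 → 0 < dy i) ∧
    (∀ i, z.2 i = 1 → dy i < 0) ∧
    (∑ i, z.2 i = (n : ℝ) - (κ : ℝ) → 0 < ∑ i, dy i) ∧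
    (∀ i, z.1 i * z.2 i = t → z.2 i * dx i + z.1 i * dy i < 0) ∧
    (∀ i, z.1 i * z.2 i = -t → 0 < z.2 i * dx i + z.1 i * dy i)

theorem isClosed_forall_of_isClosed {X ι : Type*} [TopologicalSpace X] {p : ι → X → Prop}
    (hp : ∀ i, IsClosed {x | p i x}) : IsClosed {x | ∀ i, p i x} := by
  rw [ofPred_forall]
  exact isClosed_iInter hp

/-- A closed relation that is conic in its second argument keeps a nonzero solution in the
limit. -/
theorem exists_ne_zero_mem_of_frequently {X V : Type*} [TopologicalSpace X]
    [NormedAddCommGroup V] [NormedSpace ℝ V] [ProperSpace V] {C : Set (X × V)}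
    (hC : IsClosed C) (hcone : ∀ x v, ∀ s : ℝ, 0 < s → (x, v) ∈ C → (x, s • v) ∈ C) {x₀ : X}
    (hfreq : ∃ᶠ x in 𝓝 x₀, ∃ v, v ≠ 0 ∧ (x, v) ∈ C) : ∃ v, v ≠ 0 ∧ (x₀, v) ∈ C := by
  by_contra! hcon
  have key : ∀ᶠ x in 𝓝 x₀, ∀ v ∈ Metric.sphere (0 : V) 1, (x, v) ∉ C := by
    refine (isCompact_sphere (0 : V) 1).eventually_forall_of_forall_eventually
      (P := fun x v => (x, v) ∉ C) fun v hv => ?_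
    exact hC.isOpen_compl.mem_nhds (hcon v (ne_zero_of_mem_unit_sphere ⟨v, hv⟩))
  refine hfreq (key.mono fun x hx => ?_)
  rintro ⟨v, hv, hmem⟩
  refine hx (‖v‖⁻¹ • v) ?_ (hcone x v _ (by positivity) hmem)
  simp [norm_smul, inv_mul_cancel₀ (norm_ne_zero_iff.mpr hv)]

theorem hasDerivAt_max_zero_sq (s : ℝ) :
    HasDerivAt (fun u : ℝ => max u 0 ^ 2) (2 * max s 0) s := by
  rcases lt_trichotomy s 0 with hs | rfl | hs
  · have : (fun u : ℝ => max u 0 ^ 2) =ᶠ[𝓝 s] fun _ => 0 := by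
      filter_upwards [Iio_mem_nhds hs] with u hu
      simp [max_eq_right (le_of_lt (mem_Iio.1 hu))]
    simpa [max_eq_right hs.le] using (hasDerivAt_const s (0 : ℝ)).congr_of_eventuallyEq this
  · have hO : (fun u : ℝ => max u 0 ^ 2) =O[𝓝 0] fun u => ‖u - 0‖ ^ 2 := by
      refine Asymptotics.IsBigO.of_bound 1 (Eventually.of_forall fun u => ?_)
      rcases le_total u 0 with hu | hu <;> simp [hu, sq_nonneg]
    have := (hO.hasFDerivAt one_lt_two).hasDerivAt
    simpa using this
  · have : (fun u : ℝ => max u 0 ^ 2) =ᶠ[𝓝 s] fun u => u ^ 2 := by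
      filter_upwards [Ioi_mem_nhds hs] with u hu
      rw [max_eq_left (le_of_lt (mem_Ioi.1 hu))]
    simpa [max_eq_left hs.le] using (hasDerivAt_pow 2 s).congr_of_eventuallyEq this

/-- Minimising a function with quadratic penalty terms: if `F` exceeds `F z` at every point
`w ≠ z` of a closed ball around `z` at which the penalty `P` vanishes, then for some penalty
parameter the penalised function has a local minimum in the open ball. -/
theorem exists_isLocalMin_penalty {E : Type*} [NormedAddCommGroup E] [NormedSpace ℝ E]
    [ProperSpace E] {F P : E → ℝ} (hF : Continuous F) (hP : Continuous P)
    (hP0 : ∀ w, 0 ≤ P w) {z : E} (hPz : P z = 0) {ε : ℝ} (hε : 0 < ε)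
    (hmin : ∀ w ∈ Metric.closedBall z ε, P w = 0 → w ≠ z → F z < F w) :
    ∃ k : ℕ, ∃ w ∈ Metric.ball z ε, IsLocalMin (fun v => F v + k * P v) w := by
  have hcont : ∀ k : ℕ, Continuous fun v => F v + k * P v := fun k => by fun_prop
  obtain ⟨k, hk⟩ : ∃ k : ℕ, Metric.sphere z ε ⊆ {w | F z < F w + k * P w} := by
    refine (isCompact_sphere z ε).elim_directed_cover (fun k : ℕ => {w | F z < F w + k * P w})
      (fun k => isOpen_lt continuous_const (hcont k)) (fun w hw => ?_) ?_
    · rw [mem_iUnion]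
      rcases (hP0 w).eq_or_lt with h0 | h0
      · refine ⟨0, ?_⟩
        have hne : w ≠ z := by
          rintro rfl
          simp [hε.ne] at hw
        simpa using hmin w (Metric.sphere_subset_closedBall hw) h0.symm hne
      · obtain ⟨k, hk⟩ := exists_nat_gt ((F z - F w) / P w)
        refine ⟨k, ?_⟩
        rw [div_lt_iff₀ h0] at hk
        rw [mem_ofPred_eq]
        linarith
    · refine Monotone.directed_le fun k l hkl w hw => ?_
      rw [mem_ofPred_eq] at hw ⊢
      have : (k : ℝ) * P w ≤ l * P w := by gcongr; exact hP0 w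
      linarith
  obtain ⟨w, hw, hwmin⟩ := (isCompact_closedBall z ε).exists_isMinOn
    ⟨z, Metric.mem_closedBall_self hε.le⟩ (hcont k).continuousOn
  have hwb : w ∈ Metric.ball z ε := by
    rcases (Metric.mem_closedBall.mp hw).lt_or_eq with hlt | heq
    · exact hlt
    · have h1 : F z < F w + k * P w := hk heq
      have h2 : F w + k * P w ≤ F z + k * P z := hwmin (Metric.mem_closedBall_self hε.le)
      rw [hPz] at h2
      linarith
  exact ⟨k, w, hwb, hwmin.isLocalMin
    (mem_of_superset (Metric.isOpen_ball.mem_nhds hwb) Metric.ball_subset_closedBall)⟩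

/-- The Fritz John necessary optimality conditions for a continuously differentiable program with
finitely many inequality and equality constraints. -/
theorem exists_fritzJohn_multipliers {E ι ι' : Type*} [NormedAddCommGroup E] [NormedSpace ℝ E]
    [FiniteDimensional ℝ E] [Fintype ι] [Fintype ι']
    {f : E → ℝ} {f' : E → E →L[ℝ] ℝ} {G : ι → E → ℝ} {G' : ι → E → E →L[ℝ] ℝ}
    {H : ι' → E → ℝ} {H' : ι' → E → E →L[ℝ] ℝ}
    (hf : ∀ x, HasFDerivAt f (f' x) x) (hf' : Continuous f')
    (hG : ∀ j x, HasFDerivAt (G j) (G' j x) x) (hG' : ∀ j, Continuous (G' j))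
    (hH : ∀ j x, HasFDerivAt (H j) (H' j x) x) (hH' : ∀ j, Continuous (H' j))
    {z : E} (hGz : ∀ j, G j z ≤ 0) (hHz : ∀ j, H j z = 0)
    (hmin : IsLocalMinOn f {w | (∀ j, G j w ≤ 0) ∧ ∀ j, H j w = 0} z) :
    ∃ (a : ℝ) (lam : ι → ℝ) (mu : ι' → ℝ), (a, lam, mu) ≠ 0 ∧ 0 ≤ a ∧ (∀ j, 0 ≤ lam j) ∧
      (∀ j, lam j * G j z = 0) ∧
      a • f' z + ∑ j, lam j • G' j z + ∑ j, mu j • H' j z = 0 := by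
  have : ProperSpace E := FiniteDimensional.proper ℝ E
  have hfc : Continuous f := continuous_iff_continuousAt.2 fun x => (hf x).continuousAt
  have hGc : ∀ j, Continuous (G j) := fun j =>
    continuous_iff_continuousAt.2 fun x => (hG j x).continuousAt
  have hHc : ∀ j, Continuous (H j) := fun j =>
    continuous_iff_continuousAt.2 fun x => (hH j x).continuousAt
  set q : E → ℝ := fun w => ‖toEuclidean (w - z)‖ ^ 2 with hq
  have hqd : ContDiff ℝ 1 q := by
    refine ContDiff.norm_sq ℝ ?_
    exact toEuclidean.contDiff.comp (contDiff_id.sub contDiff_const)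
  have hqc : Continuous (fderiv ℝ q) := hqd.continuous_fderiv one_ne_zero
  have hqD : ∀ x, HasFDerivAt q (fderiv ℝ q x) x := fun x =>
    (hqd.differentiable one_ne_zero x).hasFDerivAt
  have hqz : q z = 0 := by simp [hq]
  have hqpos : ∀ w, w ≠ z → 0 < q w := fun w hw => by
    have : toEuclidean (w - z) ≠ 0 := by simpa [sub_eq_zero] using hw
    positivity
  have hq'z : fderiv ℝ q z = 0 := by
    refine IsLocalMin.fderiv_eq_zero (Eventually.of_forall fun w => ?_)
    rw [hqz]
    positivity
  let C : Set (E × (ℝ × (ι → ℝ) × (ι' → ℝ))) :=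
    {c | 0 ≤ c.2.1 ∧ (∀ j, 0 ≤ c.2.2.1 j) ∧ (∀ j, c.2.2.1 j * min (G j c.1) 0 = 0) ∧
      c.2.1 • (f' c.1 + fderiv ℝ q c.1) + ∑ j, c.2.2.1 j • G' j c.1
        + ∑ j, c.2.2.2 j • H' j c.1 = 0}
  have hC : IsClosed C := by
    refine IsClosed.and (isClosed_le continuous_const (by fun_prop)) (IsClosed.and ?_
      (IsClosed.and ?_ (isClosed_eq (by fun_prop) continuous_const)))
    · exact isClosed_forall_of_isClosed fun j => isClosed_le continuous_const (by fun_prop)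
    · exact isClosed_forall_of_isClosed fun j => isClosed_eq (by fun_prop) continuous_const
  have hcone : ∀ x v, ∀ s : ℝ, 0 < s → (x, v) ∈ C → (x, s • v) ∈ C := by
    rintro x ⟨a, lam, mu⟩ s hs ⟨h1, h2, h3, h4⟩
    refine ⟨mul_nonneg hs.le h1, fun j => mul_nonneg hs.le (h2 j), fun j => ?_, ?_⟩
    · have := h3 j
      simp only [Prod.smul_fst, Prod.smul_snd, Pi.smul_apply, smul_eq_mul] at this ⊢
      rw [mul_assoc, this, mul_zero]
    · have := congrArg (s • ·) h4
      simpa [smul_add, Finset.smul_sum, smul_smul] using this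
  have hfreq : ∃ᶠ x in 𝓝 z, ∃ v, v ≠ 0 ∧ (x, v) ∈ C := by
    rw [Metric.nhds_basis_ball.frequently_iff]
    intro ε hε
    obtain ⟨r, hr, hrmin⟩ := Metric.mem_nhds_iff.1 (eventually_nhdsWithin_iff.1 hmin)
    set P : E → ℝ := fun w => ∑ j, max (G j w) 0 ^ 2 + ∑ j, H j w ^ 2 with hPdef
    have hP0 : ∀ w, 0 ≤ P w := fun w => by positivity
    obtain ⟨k, w, hw, hwmin⟩ := exists_isLocalMin_penalty (F := fun w => f w + q w) (P := P)
      (z := z) (ε := min ε (r / 2)) (hfc.add hqd.continuous) (by fun_prop) hP0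
      (by simp [hPdef, hGz, hHz]) (by positivity) (by
        intro w hw hPw hne
        rw [hPdef] at hPw
        have hsplit := (add_eq_zero_iff_of_nonneg (by positivity) (by positivity)).1 hPw
        rw [Finset.sum_eq_zero_iff_of_nonneg (fun _ _ => by positivity),
          Finset.sum_eq_zero_iff_of_nonneg (fun _ _ => by positivity)] at hsplit
        have hwr : w ∈ Metric.ball z r := by
          have := (Metric.mem_closedBall.1 hw).trans (min_le_right _ _)
          rw [Metric.mem_ball]
          linarith
        have hle : f z ≤ f w := hrmin hwr
          ⟨fun j => by simpa using hsplit.1 j (Finset.mem_univ j),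
            fun j => by simpa using hsplit.2 j (Finset.mem_univ j)⟩
        have := hqpos w hne
        simp only [hqz]
        linarith)
    refine ⟨w, Metric.ball_subset_ball (min_le_left _ _) hw,
      (1, fun j => k * (2 * max (G j w) 0), fun j => k * (2 * H j w)), ?_, ?_⟩
    · simp
    · refine ⟨zero_le_one, fun j => by positivity, fun j => ?_, ?_⟩
      · rcases le_total (G j w) 0 with hj | hj <;> simp [hj]
      · have hPd : HasFDerivAt P (∑ j, (2 * max (G j w) 0) • G' j w
            + ∑ j, (2 * H j w) • H' j w) w := by
          refine (HasFDerivAt.fun_sum fun j _ => ?_).add (HasFDerivAt.fun_sum fun j _ => ?_)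
          · exact (hasDerivAt_max_zero_sq (G j w)).comp_hasFDerivAt w (hG j w)
          · have := (hasDerivAt_pow 2 (H j w)).comp_hasFDerivAt w (hH j w)
            simp only [Nat.cast_ofNat, Nat.add_one_sub_one, pow_one] at this
            exact this
        have := hwmin.hasFDerivAt_eq_zero (((hf w).add (hqD w)).add (hPd.const_mul (k : ℝ)))
        simpa [smul_add, Finset.smul_sum, smul_smul, add_assoc] using this
  obtain ⟨⟨a, lam, mu⟩, hne, h1, h2, h3, h4⟩ := exists_ne_zero_mem_of_frequently hC hcone hfreq
  refine ⟨a, lam, mu, hne, h1, h2, fun j => ?_, ?_⟩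
  · simpa [hGz j] using h3 j
  · simpa [hq'z] using h4

theorem continuous_D1 {n : ℕ} {φ : (Fin n → ℝ) → ℝ} (hφ : ContDiff ℝ 1 φ) (d : Fin n → ℝ) :
    Continuous fun x => D1 φ x d :=
  (hφ.continuous_fderiv one_ne_zero).clm_apply continuous_const

/-- CC-MFCQ is stable: it persists at nearby points, and for multipliers `gam` that are small
relative to `‖gam‖`, instead of zero, where `xs` does not vanish. -/
theorem CCMFCQ.exists_pos_forall_eq_zero {n m p : ℕ} {g : (Fin n → ℝ) → Fin m → ℝ}
    {h : (Fin n → ℝ) → Fin p → ℝ} {xs : Fin n → ℝ} (hmfcq : CCMFCQ g h xs)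
    (hg : ∀ i, ContDiff ℝ 1 (fun x => g x i)) (hh : ∀ i, ContDiff ℝ 1 (fun x => h x i)) :
    ∃ ε > (0 : ℝ), ∀ x, dist x xs < ε → ∀ (lam : Fin m → ℝ) (mu : Fin p → ℝ) (gam : Fin n → ℝ),
      (∀ i, 0 ≤ lam i) → (∀ i, lam i * g x i = 0) → (∀ i, xs i ≠ 0 → |gam i| ≤ ε * ‖gam‖) →
      CombZero g h lam mu gam x → lam = 0 ∧ mu = 0 ∧ gam = 0 := by
  let C : Set (((Fin n → ℝ) × ℝ) × (Fin m → ℝ) × (Fin p → ℝ) × (Fin n → ℝ)) :=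
    {c | (∀ i, 0 ≤ c.2.1 i) ∧ (∀ i, c.2.1 i * g c.1.1 i = 0) ∧
      (∀ i, xs i ≠ 0 → |c.2.2.2 i| ≤ c.1.2 * ‖c.2.2.2‖) ∧
      CombZero g h c.2.1 c.2.2.1 c.2.2.2 c.1.1}
  have hgc : ∀ i, Continuous fun x => g x i := fun i => (hg i).continuous
  have hC : IsClosed C := by
    refine IsClosed.and ?_ (IsClosed.and ?_ (IsClosed.and ?_ ?_))
    · exact isClosed_forall_of_isClosed fun i => isClosed_le continuous_const (by fun_prop)
    · refine isClosed_forall_of_isClosed fun i => isClosed_eq ?_ continuous_const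
      exact Continuous.mul (by fun_prop) ((hgc i).comp (by fun_prop))
    · exact isClosed_forall_of_isClosed fun i => isClosed_imp isOpen_const
        (isClosed_le (by fun_prop) (by fun_prop))
    · refine isClosed_forall_of_isClosed fun d => isClosed_eq ?_ continuous_const
      refine ((continuous_finsetSum _ fun i _ => ?_).add
        (continuous_finsetSum _ fun i _ => ?_)).add (by fun_prop)
      · exact Continuous.mul (by fun_prop) ((continuous_D1 (hg i) d).comp (by fun_prop))
      · exact Continuous.mul (by fun_prop) ((continuous_D1 (hh i) d).comp (by fun_prop))
  have hcone : ∀ x v, ∀ s : ℝ, 0 < s → (x, v) ∈ C → (x, s • v) ∈ C := by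
    rintro ⟨x, ε⟩ ⟨lam, mu, gam⟩ s hs ⟨h1, h2, h3, h4⟩
    refine ⟨fun i => mul_nonneg hs.le (h1 i), fun i => ?_, fun i hi => ?_, fun d => ?_⟩
    · have := h2 i
      simp only [Prod.smul_fst, Pi.smul_apply, smul_eq_mul] at this ⊢
      rw [mul_assoc, this, mul_zero]
    · have := mul_le_mul_of_nonneg_left (h3 i hi) hs.le
      simp only [Prod.smul_snd, Pi.smul_apply, smul_eq_mul, norm_smul, abs_mul,
        Real.norm_eq_abs, abs_of_pos hs] at this ⊢
      linarith
    · have := congrArg (s * ·) (h4 d)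
      simpa [mul_add, Finset.mul_sum, mul_assoc] using this
  have hnot : ¬ ∃ᶠ x in 𝓝 (xs, (0 : ℝ)), ∃ v, v ≠ 0 ∧ (x, v) ∈ C := fun hfreq => by
    obtain ⟨⟨lam, mu, gam⟩, hne, h1, h2, h3, h4⟩ :=
      exists_ne_zero_mem_of_frequently hC hcone hfreq
    obtain ⟨rfl, rfl, rfl⟩ := hmfcq lam mu gam h1
      (fun i hi => (mul_eq_zero.1 (h2 i)).resolve_right hi) (fun i hi => by simpa using h3 i hi) h4
    exact hne rfl
  obtain ⟨ε, hε, hball⟩ := Metric.eventually_nhds_iff.1 (not_frequently.1 hnot)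
  refine ⟨ε / 2, half_pos hε, fun x hx lam mu gam h1 h2 h3 h4 => ?_⟩
  have hd : dist (x, ε / 2) (xs, (0 : ℝ)) < ε := by
    rw [Prod.dist_eq, max_lt_iff]
    refine ⟨hx.trans (half_lt_self hε), ?_⟩
    simp [abs_of_pos hε, hε]
  have := hball hd
  push Not at this
  by_contra hne
  refine this (lam, mu, gam) (fun h0 => hne ?_) ⟨h1, h2, h3, h4⟩
  simpa using h0

theorem card0_eq_sum {n : ℕ} (x : Fin n → ℝ) :
    (card0 x : ℝ) = (n : ℝ) - ∑ i, if x i = 0 then (1 : ℝ) else 0 := by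
  have h1 : card0 x = (Finset.univ.filter fun i => x i ≠ 0).card := by
    rw [card0, ← Set.ncard_coe_finset]
    simp
  have h2 := Finset.card_filter_add_card_filter_not (s := (Finset.univ : Finset (Fin n)))
    (fun i => x i = 0)
  rw [Finset.card_univ, Fintype.card_fin] at h2
  have h3 := congrArg (Nat.cast (R := ℝ)) h2
  rw [Nat.cast_add] at h3
  rw [h1, Finset.sum_boole, ← h3]
  ring

/-- Near a point satisfying CC-MFCQ, and for small `t`, the constraints of NLP(t) admit no
nontrivial abnormal (Fritz John) multipliers. -/
theorem CCMFCQ.abnormal_multipliers_eq_zero {n m p : ℕ} {g : (Fin n → ℝ) → Fin m → ℝ}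
    {h : (Fin n → ℝ) → Fin p → ℝ} {κ : ℕ} (hκ0 : 0 < κ) {xs : Fin n → ℝ}
    (hmfcq : CCMFCQ g h xs) (hcard : card0 xs ≤ κ)
    (hg : ∀ i, ContDiff ℝ 1 (fun x => g x i)) (hh : ∀ i, ContDiff ℝ 1 (fun x => h x i)) :
    ∃ δ > (0 : ℝ), ∃ T > (0 : ℝ), ∀ t, 0 < t → t ≤ T → ∀ z ∈ ZReg g h κ t, dist z.1 xs < δ →
      ∀ (lam : Fin m → ℝ) (mu : Fin p → ℝ) (nu0 nu1 : Fin n → ℝ) (rho : ℝ) (dpl dmi : Fin n → ℝ),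
      (∀ d : Fin n → ℝ, ∑ i, lam i * D1 (fun x' => g x' i) z.1 d
        + ∑ i, mu i * D1 (fun x' => h x' i) z.1 d
        + ∑ i, (dpl i - dmi i) * z.2 i * d i = 0) →
      (∀ i, -nu0 i + nu1 i - rho + (dpl i - dmi i) * z.1 i = 0) →
      (∀ i, 0 ≤ lam i) → (∀ i, 0 ≤ nu0 i) → (∀ i, 0 ≤ nu1 i) → 0 ≤ rho →
      (∀ i, 0 ≤ dpl i) → (∀ i, 0 ≤ dmi i) →
      (∀ i, lam i * g z.1 i = 0) → (∀ i, nu0 i * z.2 i = 0) → (∀ i, nu1 i * (z.2 i - 1) = 0) →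
      rho * (∑ i, z.2 i - ((n : ℝ) - (κ : ℝ))) = 0 →
      (∀ i, dpl i * (z.1 i * z.2 i - t) = 0) → (∀ i, dmi i * (z.1 i * z.2 i + t) = 0) →
      lam = 0 ∧ mu = 0 ∧ nu0 = 0 ∧ nu1 = 0 ∧ rho = 0 ∧ dpl = 0 ∧ dmi = 0 := by
  obtain ⟨ε, hε, hA⟩ := hmfcq.exists_pos_forall_eq_zero hg hh
  obtain ⟨c, hc, hcle⟩ : ∃ c > (0 : ℝ), ∀ i, xs i ≠ 0 → c ≤ |xs i| := by
    obtain ⟨c, hc, hle⟩ := (Set.toFinite {i | xs i ≠ 0}).isCompact.exists_forall_le'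
      (f := fun i => |xs i|) (a := 0) (continuous_of_discreteTopology.continuousOn)
      fun i hi => abs_pos.2 hi
    exact ⟨c, hc, hle⟩
  obtain ⟨δ, hδ, hδε, hδc, hδsq⟩ :
      ∃ δ > (0 : ℝ), δ ≤ ε ∧ δ ≤ c / 2 ∧ 4 * δ ^ 2 ≤ ε * c ^ 2 := by
    refine ⟨min ε (min (c / 2) (c * √ε / 2)), by positivity, min_le_left _ _,
      (min_le_right _ _).trans (min_le_left _ _), ?_⟩
    have h1 : min ε (min (c / 2) (c * √ε / 2)) ≤ c * √ε / 2 :=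
      (min_le_right _ _).trans (min_le_right _ _)
    calc 4 * min ε (min (c / 2) (c * √ε / 2)) ^ 2 ≤ 4 * (c * √ε / 2) ^ 2 := by gcongr
      _ = ε * c ^ 2 := by
        rw [div_pow, mul_pow, Real.sq_sqrt hε.le]
        ring
  refine ⟨δ, hδ, c / 4, by positivity, ?_⟩
  rintro t ht htc ⟨x, y⟩ ⟨-, -, hy0, hy1, hysum, hxyu, hxyl⟩ hx lam mu nu0 nu1 rho dpl dmi
    hdx hdy hlam hnu0 hnu1 hrho hdpl hdmi hlamc hnu0c hnu1c hrhoc hdplc hdmic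
  simp only at *
  have hxi : ∀ i, |x i - xs i| < δ := fun i => by
    simpa [Real.dist_eq] using (dist_le_pi_dist x xs i).trans_lt hx
  have habs : ∀ i, (dpl i - dmi i) * x i * y i = |dpl i - dmi i| * t := fun i => by
    rcases (hdpl i).eq_or_lt with h0 | h0
    · rw [← h0, zero_sub, abs_neg, abs_of_nonneg (hdmi i)]
      linarith [hdmic i]
    · have h1 : x i * y i = t := by
        linarith [(mul_eq_zero.1 (hdplc i)).resolve_left h0.ne']
      have h2 : dmi i = 0 := (mul_eq_zero.1 (hdmic i)).resolve_right (by rw [h1]; positivity)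
      rw [h2, sub_zero, abs_of_pos h0, mul_assoc, h1]
  have hkey : ∀ i, nu1 i + |dpl i - dmi i| * t = rho * y i := fun i => by
    linear_combination y i * hdy i + hnu0c i - hnu1c i - habs i
  have hcomb : CombZero g h lam mu (fun i => (dpl i - dmi i) * y i) x := hdx
  have hxε : dist x xs < ε := hx.trans_le hδε
  have hrho0 : rho = 0 := by
    by_contra hne
    have hrpos : 0 < rho := lt_of_le_of_ne hrho (Ne.symm hne)
    have hsum : ∑ i, y i = (n : ℝ) - κ := by
      linarith [(mul_eq_zero.1 hrhoc).resolve_left hne]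
    have hypos : ∀ i, 0 < y i := fun i => by
      refine lt_of_le_of_ne (hy0 i) fun h0 => ?_
      have h1 := hkey i
      have h2 := hdy i
      rw [← h0, mul_zero] at h1
      have h3 : |dpl i - dmi i| * t = 0 := by
        have : 0 ≤ |dpl i - dmi i| * t := by positivity
        linarith [hnu1 i]
      have h4 : dpl i - dmi i = 0 := by simpa [ht.ne'] using h3
      rw [h4] at h2
      linarith [hnu0 i]
    obtain ⟨i₀, hi₀, hy₀⟩ : ∃ i, xs i = 0 ∧ y i < 1 := by
      by_contra! hall
      have hle : ∀ i ∈ Finset.univ, (if xs i = 0 then (1 : ℝ) else 0) ≤ y i := fun i _ => by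
        split_ifs with hi
        · exact hall i hi
        · exact hy0 i
      have hc0 := card0_eq_sum xs
      have hcκ : (card0 xs : ℝ) ≤ κ := by exact_mod_cast hcard
      have heq := (Finset.sum_eq_sum_iff_of_le hle).1
        (le_antisymm (Finset.sum_le_sum hle) (by linarith))
      have hone : ∀ i, y i = 1 := fun i => by
        have h1 := heq i (Finset.mem_univ i)
        have h2 := hypos i
        split_ifs at h1 <;> linarith
      simp only [hone, Finset.sum_const, Finset.card_univ, Fintype.card_fin, nsmul_eq_mul,
        mul_one] at hsum
      have : (0 : ℝ) < κ := by exact_mod_cast hκ0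
      linarith
    have hkey' : ∀ i, y i < 1 → |(dpl i - dmi i) * y i| * t = rho * y i ^ 2 := fun i hi => by
      have h1 : nu1 i = 0 := (mul_eq_zero.1 (hnu1c i)).resolve_right (by linarith)
      have h2 := hkey i
      rw [abs_mul, abs_of_pos (hypos i)]
      linear_combination y i * h2 - y i * h1
    have hD₀ : 0 < |(dpl i₀ - dmi i₀) * y i₀| := by
      have h1 := hkey' i₀ hy₀
      have h2 : 0 < rho * y i₀ ^ 2 := by have := hypos i₀; positivity
      exact pos_of_mul_pos_left (h1 ▸ h2) ht.le
    have hxy₀ : t ≤ δ * y i₀ := by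
      have h1 : |x i₀| < δ := by simpa [hi₀] using hxi i₀
      have h2 : |dpl i₀ - dmi i₀| * t ≤ |dpl i₀ - dmi i₀| * (|x i₀| * y i₀) := by
        rw [← habs, ← mul_assoc, ← abs_mul]
        exact mul_le_mul_of_nonneg_right (le_abs_self _) (hy0 i₀)
      have h3 : 0 < |dpl i₀ - dmi i₀| := by
        rw [abs_mul] at hD₀
        exact pos_of_mul_pos_left hD₀ (abs_nonneg _)
      have h4 := le_of_mul_le_mul_left h2 h3
      have := mul_le_mul_of_nonneg_right h1.le (hy0 i₀)
      linarith
    have hsmall : ∀ i, xs i ≠ 0 → |(dpl i - dmi i) * y i| ≤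
        ε * ‖fun i => (dpl i - dmi i) * y i‖ := fun i hi => by
      have h1 : c / 2 ≤ |x i| := by
        have h2 := hcle i hi
        have h3 := hxi i
        have h4 := abs_sub_abs_le_abs_sub (xs i) (x i)
        rw [abs_sub_comm] at h4
        linarith
      have h2 : |x i| * y i ≤ t := by
        rw [← abs_of_nonneg (hy0 i), ← abs_mul, abs_le]
        exact ⟨hxyl i, hxyu i⟩
      have h3 : c / 2 * y i ≤ t := (mul_le_mul_of_nonneg_right h1 (hy0 i)).trans h2
      have h4 : y i < 1 := by nlinarith
      have h5 : c * y i ≤ 2 * δ * y i₀ := by linarith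
      have h6 : y i ^ 2 ≤ ε * y i₀ ^ 2 := by
        have h7 : (c * y i) ^ 2 ≤ (2 * δ * y i₀) ^ 2 :=
          pow_le_pow_left₀ (mul_nonneg hc.le (hy0 i)) h5 2
        have h8 : 4 * δ ^ 2 * y i₀ ^ 2 ≤ ε * c ^ 2 * y i₀ ^ 2 := by gcongr
        have h9 : c ^ 2 * y i ^ 2 ≤ c ^ 2 * (ε * y i₀ ^ 2) := by linarith
        exact le_of_mul_le_mul_left h9 (by positivity)
      have h7 : |(dpl i - dmi i) * y i| ≤ ε * |(dpl i₀ - dmi i₀) * y i₀| := by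
        refine le_of_mul_le_mul_right ?_ ht
        rw [hkey' i h4, mul_assoc, hkey' i₀ hy₀]
        have := mul_le_mul_of_nonneg_left h6 hrho
        linarith
      refine h7.trans (mul_le_mul_of_nonneg_left ?_ hε.le)
      exact norm_le_pi_norm (fun i => (dpl i - dmi i) * y i) i₀
    have hzero := (hA x hxε lam mu _ hlam hlamc hsmall hcomb).2.2
    have := congrFun hzero i₀
    simp only [Pi.zero_apply] at this
    simp [this] at hD₀
  subst hrho0
  have hD : ∀ i, nu1 i = 0 ∧ dpl i - dmi i = 0 := fun i => by
    have h1 := hkey i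
    have h2 : 0 ≤ |dpl i - dmi i| * t := by positivity
    have h3 := hnu1 i
    have h4 : |dpl i - dmi i| * t = 0 := by linarith
    exact ⟨by linarith, by simpa [ht.ne'] using h4⟩
  obtain ⟨rfl, rfl, -⟩ := hA x hxε lam mu _ hlam hlamc
    (fun i _ => by simp only [(hD i).2, zero_mul, abs_zero]; positivity) hcomb
  have hpm : ∀ i, dpl i = 0 := fun i => by
    by_contra hne
    have h1 := (mul_eq_zero.1 (hdplc i)).resolve_left hne
    have h2 : dmi i ≠ 0 := by
      rw [← sub_eq_zero.1 (hD i).2]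
      exact hne
    have h3 := (mul_eq_zero.1 (hdmic i)).resolve_left h2
    linarith
  refine ⟨rfl, rfl, funext fun i => ?_, funext fun i => (hD i).1, rfl, funext hpm,
    funext fun i => ?_⟩
  · have := hdy i
    rw [(hD i).1, (hD i).2] at this
    simpa using this
  · have := (hD i).2
    rw [hpm i] at this
    simpa using this

/-- Near a strict local minimum of CCP, the regularized programs NLP(t) have local minima for all
small `t`. -/
theorem StrictLocalMinCCP.exists_localMinReg {n m p : ℕ} {f : (Fin n → ℝ) → ℝ}
    {g : (Fin n → ℝ) → Fin m → ℝ} {h : (Fin n → ℝ) → Fin p → ℝ} {κ : ℕ} {xs : Fin n → ℝ}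
    (hmin : StrictLocalMinCCP f g h κ xs) (hf : Continuous f)
    (hg : ∀ i, Continuous fun x => g x i) (hh : ∀ i, Continuous fun x => h x i)
    {δ : ℝ} (hδ : 0 < δ) :
    ∃ T > (0 : ℝ), ∀ t, 0 < t → t ≤ T → ∃ z, LocalMinReg f g h κ t z ∧ dist z.1 xs < δ := by
  obtain ⟨⟨hgs, hhs, hcard⟩, r, hr, hstrict⟩ := hmin
  obtain ⟨ρ, hρ, hρδ, hρr⟩ : ∃ ρ > (0 : ℝ), ρ ≤ δ ∧ ρ < r :=
    ⟨min δ (r / 2), by positivity, min_le_left _ _,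
      (min_le_right _ _).trans_lt (half_lt_self hr)⟩
  let B : Set ((Fin n → ℝ) × (Fin n → ℝ)) :=
    {z | (∀ i, g z.1 i ≤ 0) ∧ (∀ i, h z.1 i = 0) ∧ (n : ℝ) - κ ≤ ∑ i, z.2 i} ∩
      Metric.closedBall xs ρ ×ˢ Set.Icc 0 1
  have hB : IsCompact B := by
    refine ((isCompact_closedBall xs ρ).prod isCompact_Icc).inter_left ?_
    refine IsClosed.and ?_ (IsClosed.and ?_ (isClosed_le continuous_const (by fun_prop)))
    · exact isClosed_forall_of_isClosed fun i =>
        isClosed_le ((hg i).comp continuous_fst) continuous_const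
    · exact isClosed_forall_of_isClosed fun i =>
        isClosed_eq ((hh i).comp continuous_fst) continuous_const
  let S := B ∩ {z | dist z.1 xs = ρ ∧ f z.1 ≤ f xs}
  have hS : IsCompact S :=
    hB.inter_right ((isClosed_eq (by fun_prop) continuous_const).and
      (isClosed_le (hf.comp continuous_fst) continuous_const))
  have hSpos : ∀ z ∈ S, 0 < ∑ i, |z.1 i * z.2 i| := by
    rintro ⟨x, y⟩ ⟨⟨⟨hgx, hhx, hy⟩, hxb, hy0, hy1⟩, hd, hfx⟩
    refine lt_of_le_of_ne (Finset.sum_nonneg fun i _ => abs_nonneg _) fun h0 => ?_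
    have hxy : ∀ i, x i * y i = 0 := fun i => by
      simpa using (Finset.sum_eq_zero_iff_of_nonneg fun i _ => abs_nonneg (x i * y i)).1 h0.symm i
        (Finset.mem_univ i)
    have hle : ∑ i, y i ≤ ∑ i, if x i = 0 then (1 : ℝ) else 0 :=
      Finset.sum_le_sum fun i _ => by
        split_ifs with hi
        · exact hy1 i
        · exact ((mul_eq_zero.1 (hxy i)).resolve_left hi).le
    have hcx : card0 x ≤ κ := by
      have h1 := card0_eq_sum x
      have h2 : (card0 x : ℝ) ≤ κ := by
        simp only at hy
        linarith
      exact_mod_cast h2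
    have hne : x ≠ xs := by
      rintro rfl
      simp [hρ.ne] at hd
    simp only at hd hfx
    exact absurd (hstrict x ⟨hgx, hhx, hcx⟩ (by rw [hd]; exact hρr) hne) hfx.not_gt
  obtain ⟨b, hb, hbS⟩ := hS.exists_forall_le' (by fun_prop) hSpos
  refine ⟨b / (n + 1), by positivity, fun t ht htT => ?_⟩
  have hnt : n * t < b := by
    rw [le_div_iff₀ (by positivity)] at htT
    linarith
  have hmem : ∀ z, z ∈ B ∩ {z | ∀ i, |z.1 i * z.2 i| ≤ t} ↔
      z ∈ ZReg g h κ t ∧ dist z.1 xs ≤ ρ := by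
    rintro ⟨x, y⟩
    simp only [B, ZReg, mem_inter_iff, mem_ofPred_eq, mem_prod, Metric.mem_closedBall, mem_Icc,
      Pi.le_def, Pi.zero_apply, Pi.one_apply, abs_le, forall_and]
    tauto
  have hcompact : IsCompact (B ∩ {z | ∀ i, |z.1 i * z.2 i| ≤ t}) :=
    hB.inter_right (isClosed_forall_of_isClosed fun i => isClosed_le (by fun_prop) (by fun_prop))
  have hxsmem : (xs, fun i => if xs i = 0 then (1 : ℝ) else 0) ∈
      B ∩ {z | ∀ i, |z.1 i * z.2 i| ≤ t} := by
    refine ⟨⟨⟨hgs, hhs, ?_⟩, Metric.mem_closedBall_self hρ.le, fun i => ?_, fun i => ?_⟩,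
      fun i => ?_⟩
    · have h1 := card0_eq_sum xs
      have h2 : (card0 xs : ℝ) ≤ κ := by exact_mod_cast hcard
      simp only
      linarith
    · by_cases hi : xs i = 0 <;> simp [hi]
    · by_cases hi : xs i = 0 <;> simp [hi]
    · by_cases hi : xs i = 0 <;> simp [hi, ht.le]
  obtain ⟨z, hz, hzmin⟩ := hcompact.exists_isMinOn ⟨_, hxsmem⟩
    (hf.comp continuous_fst).continuousOn
  obtain ⟨hzZ, hzρ⟩ := (hmem z).1 hz
  have hfz : f z.1 ≤ f xs := hzmin hxsmem
  have hlt : dist z.1 xs < ρ := by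
    refine lt_of_le_of_ne hzρ fun heq => ?_
    have h1 := hbS z ⟨hz.1, heq, hfz⟩
    have h2 : ∑ i, |z.1 i * z.2 i| ≤ ∑ _i : Fin n, t := Finset.sum_le_sum fun i _ => hz.2 i
    simp only [Finset.sum_const, Finset.card_univ, Fintype.card_fin, nsmul_eq_mul] at h2
    linarith
  refine ⟨z, ⟨hzZ, ρ - dist z.1 xs, sub_pos.2 hlt, fun z' hz' hd => ?_⟩, hlt.trans_le hρδ⟩
  refine hzmin ((hmem z').2 ⟨hz', ?_⟩)
  have h1 : dist z'.1 z.1 ≤ dist z' z := le_max_left _ _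
  have h2 := dist_triangle z'.1 z.1 xs
  linarith

/-- The Fritz John conditions for NLP(t): the KKT conditions with a multiplier `a ≥ 0` of the
objective, at least one multiplier being nonzero. -/
theorem LocalMinReg.exists_fritzJohn_multipliers {n m p : ℕ} {f : (Fin n → ℝ) → ℝ}
    {g : (Fin n → ℝ) → Fin m → ℝ} {h : (Fin n → ℝ) → Fin p → ℝ} {κ : ℕ} {t : ℝ}
    {z : (Fin n → ℝ) × (Fin n → ℝ)} (hmin : LocalMinReg f g h κ t z) (hf : ContDiff ℝ 1 f)
    (hg : ∀ i, ContDiff ℝ 1 (fun x => g x i)) (hh : ∀ i, ContDiff ℝ 1 (fun x => h x i)) :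
    ∃ (a : ℝ) (lam : Fin m → ℝ) (mu : Fin p → ℝ) (nu0 nu1 : Fin n → ℝ) (rho : ℝ)
      (dpl dmi : Fin n → ℝ), 0 ≤ a ∧
      ¬ (a = 0 ∧ lam = 0 ∧ mu = 0 ∧ nu0 = 0 ∧ nu1 = 0 ∧ rho = 0 ∧ dpl = 0 ∧ dmi = 0) ∧
      (∀ d : Fin n → ℝ, a * D1 f z.1 d + ∑ i, lam i * D1 (fun x' => g x' i) z.1 d
        + ∑ i, mu i * D1 (fun x' => h x' i) z.1 d
        + ∑ i, (dpl i - dmi i) * z.2 i * d i = 0) ∧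
      (∀ i, -nu0 i + nu1 i - rho + (dpl i - dmi i) * z.1 i = 0) ∧
      (∀ i, 0 ≤ lam i) ∧ (∀ i, 0 ≤ nu0 i) ∧ (∀ i, 0 ≤ nu1 i) ∧ 0 ≤ rho ∧
      (∀ i, 0 ≤ dpl i) ∧ (∀ i, 0 ≤ dmi i) ∧
      (∀ i, lam i * g z.1 i = 0) ∧ (∀ i, nu0 i * z.2 i = 0) ∧ (∀ i, nu1 i * (z.2 i - 1) = 0) ∧
      rho * (∑ i, z.2 i - ((n : ℝ) - (κ : ℝ))) = 0 ∧
      (∀ i, dpl i * (z.1 i * z.2 i - t) = 0) ∧ (∀ i, dmi i * (z.1 i * z.2 i + t) = 0) := by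
  let X : (Fin n → ℝ) × (Fin n → ℝ) →L[ℝ] (Fin n → ℝ) := ContinuousLinearMap.fst ℝ _ _
  let x (i : Fin n) : (Fin n → ℝ) × (Fin n → ℝ) →L[ℝ] ℝ := (ContinuousLinearMap.proj i).comp X
  let y (i : Fin n) : (Fin n → ℝ) × (Fin n → ℝ) →L[ℝ] ℝ :=
    (ContinuousLinearMap.proj i).comp (ContinuousLinearMap.snd ℝ _ _)
  let G : Fin m ⊕ Fin n ⊕ Fin n ⊕ Unit ⊕ Fin n ⊕ Fin n →
      (Fin n → ℝ) × (Fin n → ℝ) → ℝ :=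
    Sum.elim (fun i w => g w.1 i) <| Sum.elim (fun i w => -w.2 i) <|
    Sum.elim (fun i w => w.2 i - 1) <| Sum.elim (fun _ w => (n : ℝ) - κ - ∑ i, w.2 i) <|
    Sum.elim (fun i w => w.1 i * w.2 i - t) (fun i w => -t - w.1 i * w.2 i)
  let G' : Fin m ⊕ Fin n ⊕ Fin n ⊕ Unit ⊕ Fin n ⊕ Fin n →
      (Fin n → ℝ) × (Fin n → ℝ) → ((Fin n → ℝ) × (Fin n → ℝ) →L[ℝ] ℝ) :=
    Sum.elim (fun i w => (fderiv ℝ (fun x => g x i) w.1).comp X) <|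
    Sum.elim (fun i _ => -y i) <| Sum.elim (fun i _ => y i) <|
    Sum.elim (fun _ _ => -∑ i, y i) <|
    Sum.elim (fun i w => w.1 i • y i + w.2 i • x i) (fun i w => -(w.1 i • y i + w.2 i • x i))
  have hx : ∀ i w, HasFDerivAt (fun w : (Fin n → ℝ) × (Fin n → ℝ) => w.1 i) (x i) w :=
    fun i w => (x i).hasFDerivAt
  have hy : ∀ i w, HasFDerivAt (fun w : (Fin n → ℝ) × (Fin n → ℝ) => w.2 i) (y i) w :=
    fun i w => (y i).hasFDerivAt
  have hcomp : ∀ {φ : (Fin n → ℝ) → ℝ}, ContDiff ℝ 1 φ → ∀ w : (Fin n → ℝ) × (Fin n → ℝ),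
      HasFDerivAt (fun w : (Fin n → ℝ) × (Fin n → ℝ) => φ w.1) ((fderiv ℝ φ w.1).comp X) w :=
    fun hφ w =>
    (hφ.differentiable one_ne_zero w.1).hasFDerivAt.comp w hasFDerivAt_fst
  have hcomp' : ∀ {φ : (Fin n → ℝ) → ℝ}, ContDiff ℝ 1 φ →
      Continuous fun w : (Fin n → ℝ) × (Fin n → ℝ) => (fderiv ℝ φ w.1).comp X := fun hφ =>
    ((hφ.continuous_fderiv one_ne_zero).comp continuous_fst).clm_comp continuous_const
  have hG : ∀ j w, HasFDerivAt (G j) (G' j w) w := by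
    rintro (i | i | i | i | i | i) w
    · exact hcomp (hg i) w
    · exact (hy i w).neg
    · exact (hy i w).sub_const 1
    · exact (HasFDerivAt.fun_sum fun i _ => hy i w).const_sub _
    · exact ((hx i w).mul (hy i w)).sub_const t
    · exact ((hx i w).mul (hy i w)).const_sub (-t)
  have hG' : ∀ j, Continuous (G' j) := by
    rintro (i | i | i | i | i | i)
    · exact hcomp' (hg i)
    · exact continuous_const
    · exact continuous_const
    · exact continuous_const
    · simp only [G', Sum.elim_inl, Sum.elim_inr]
      fun_prop
    · simp only [G', Sum.elim_inr]
      fun_prop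
  have hfeas : ∀ w : (Fin n → ℝ) × (Fin n → ℝ),
      (∀ j, G j w ≤ 0) ∧ (∀ j, h w.1 j = 0) ↔ w ∈ ZReg g h κ t := fun w => by
    simp only [G, Sum.forall, Sum.elim_inl, Sum.elim_inr, ZReg, mem_ofPred_eq, forall_const,
      sub_nonpos, neg_nonpos]
    tauto
  obtain ⟨hzZ, r, hr, hle⟩ := hmin
  obtain ⟨a, lam, mu, hne, ha, hlam, hslack, hsum⟩ :=
    _root_.exists_fritzJohn_multipliers (f := fun w : (Fin n → ℝ) × (Fin n → ℝ) => f w.1)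
      (G := G) (G' := G') (H := fun i (w : (Fin n → ℝ) × (Fin n → ℝ)) => h w.1 i)
      (hcomp hf) (hcomp' hf) hG hG' (fun i => hcomp (hh i)) (fun i => hcomp' (hh i))
      ((hfeas z).2 hzZ).1 ((hfeas z).2 hzZ).2 (by
        refine eventually_nhdsWithin_iff.2 ?_
        filter_upwards [Metric.ball_mem_nhds z hr] with w hw hwZ
        exact hle w ((hfeas w).1 hwZ) hw)
  simp only [Sum.forall, G, Sum.elim_inl, Sum.elim_inr] at hlam hslack
  obtain ⟨s1, s2, s3, s4, s5, s6⟩ := hslack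
  obtain ⟨l1, l2, l3, l4, l5, l6⟩ := hlam
  simp only [Fintype.sum_sum_type, G', Sum.elim_inl, Sum.elim_inr, Finset.univ_unique,
    Finset.sum_singleton] at hsum
  refine ⟨a, fun i => lam (.inl i), mu, fun i => lam (.inr (.inl i)),
    fun i => lam (.inr (.inr (.inl i))), lam (.inr (.inr (.inr (.inl ())))),
    fun i => lam (.inr (.inr (.inr (.inr (.inl i))))),
    fun i => lam (.inr (.inr (.inr (.inr (.inr i))))), ha, ?_, fun d => ?_, fun i => ?_,
    l1, l2, l3, l4 (), l5, l6, s1, fun i => ?_, s3, ?_, s5, fun i => ?_⟩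
  · rintro ⟨rfl, e1, rfl, e2, e3, e4, e5, e6⟩
    refine hne (Prod.ext rfl (Prod.ext (funext ?_) rfl))
    rintro (i | i | i | i | i | i)
    exacts [congrFun e1 i, congrFun e2 i, congrFun e3 i, e4, congrFun e5 i, congrFun e6 i]
  · have := congrArg (fun L : (Fin n → ℝ) × (Fin n → ℝ) →L[ℝ] ℝ => L (d, 0)) hsum
    simp [X, x, y] at this
    simp only [D1, sub_mul, Finset.sum_sub_distrib]
    simp only [mul_assoc]
    linarith
  · have := congrArg (fun L : (Fin n → ℝ) × (Fin n → ℝ) →L[ℝ] ℝ => L (0, Pi.single i 1)) hsum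
    simp [X, x, y, Pi.single_apply] at this
    linarith
  · linarith [s2 i]
  · linarith [s4 ()]
  · linarith [s6 i]

theorem stmt13
    {n m p : ℕ} (f : (Fin n → ℝ) → ℝ) (g : (Fin n → ℝ) → Fin m → ℝ)
    (h : (Fin n → ℝ) → Fin p → ℝ) (κ : ℕ)
    (hn : 0 < n) (hm : 0 < m) (hp : 0 < p) (hκ0 : 0 < κ) (hκn : κ < n)
    (hf : ContDiff ℝ 1 f) (hg : ∀ i, ContDiff ℝ 1 (fun x => g x i))
    (hh : ∀ i, ContDiff ℝ 1 (fun x => h x i))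
    (xs : Fin n → ℝ) (hmin : StrictLocalMinCCP f g h κ xs) (hmfcq : CCMFCQ g h xs) :
    ∃ T > (0 : ℝ), ∃ r > (0 : ℝ), ∀ t : ℝ, 0 < t → t ≤ T →
      ∃ z : (Fin n → ℝ) × (Fin n → ℝ),
        LocalMinReg f g h κ t z ∧ KKTReg f g h κ t z ∧ dist z.1 xs < r := by
  obtain ⟨δ, hδ, T₁, hT₁, hnormal⟩ :=
    hmfcq.abnormal_multipliers_eq_zero hκ0 hmin.1.2.2 hg hh
  obtain ⟨T₂, hT₂, hexists⟩ := hmin.exists_localMinReg hf.continuous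
    (fun i => (hg i).continuous) (fun i => (hh i).continuous) hδ
  refine ⟨min T₁ T₂, lt_min hT₁ hT₂, δ, hδ, fun t ht htT => ?_⟩
  obtain ⟨z, hz, hzδ⟩ := hexists t ht (htT.trans (min_le_right _ _))
  refine ⟨z, hz, ⟨hz.1, ?_⟩, hzδ⟩
  obtain ⟨a, lam, mu, nu0, nu1, rho, dpl, dmi, ha, hne, hdx, hdy, hlam, hnu0, hnu1, hrho, hdpl,
    hdmi, hlamc, hnu0c, hnu1c, hrhoc, hdplc, hdmic⟩ := hz.exists_fritzJohn_multipliers hf hg hh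
  rcases ha.eq_or_lt with rfl | ha
  · exact absurd ⟨rfl, hnormal t ht (htT.trans (min_le_left _ _)) z hz.1 hzδ lam mu nu0 nu1 rho
      dpl dmi (by simpa using hdx) hdy hlam hnu0 hnu1 hrho hdpl hdmi hlamc hnu0c hnu1c hrhoc
      hdplc hdmic⟩ hne
  · refine ⟨a⁻¹ • lam, a⁻¹ • mu, a⁻¹ • nu0, a⁻¹ • nu1, a⁻¹ * rho, a⁻¹ • dpl, a⁻¹ • dmi,
      fun d => ?_, fun i => ?_, fun i => ?_, fun i => ?_, fun i => ?_, by positivity, fun i => ?_,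
      fun i => ?_, fun i => ?_, fun i => ?_, fun i => ?_, ?_, fun i => ?_, fun i => ?_⟩
    · have := congrArg (a⁻¹ * ·) (hdx d)
      simpa only [mul_add, Finset.mul_sum, inv_mul_cancel_left₀ ha.ne', mul_zero, Pi.smul_apply,
        smul_eq_mul, ← mul_sub, mul_assoc] using this
    · simp only [Pi.smul_apply, smul_eq_mul]
      linear_combination a⁻¹ * hdy i
    all_goals simp only [Pi.smul_apply, smul_eq_mul, mul_assoc]
    · exact mul_nonneg (inv_nonneg.2 ha.le) (hlam i)
    · exact mul_nonneg (inv_nonneg.2 ha.le) (hnu0 i)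
    · exact mul_nonneg (inv_nonneg.2 ha.le) (hnu1 i)
    · exact mul_nonneg (inv_nonneg.2 ha.le) (hdpl i)
    · exact mul_nonneg (inv_nonneg.2 ha.le) (hdmi i)
    · rw [hlamc i, mul_zero]
    · rw [hnu0c i, mul_zero]
    · rw [hnu1c i, mul_zero]
    · rw [hrhoc, mul_zero]
    · rw [hdplc i, mul_zero]
    · rw [hdmic i, mul_zero]
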